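/- Let R be a noetherian integral domain with field of fractions Q such that every fractional ideal of R is divisorial and such that R/aR is finite for every a ∈ R×. Then I(R) is independent if and only if R is integrally closed in Q. -/

import Mathlib

/-- A family `F` of subsets is independent if whenever `X, X₁, …, Xₙ ∈ F`
satisfy `X = X₁ ∪ … ∪ Xₙ`, then `X = Xᵢ` for some `i`. -/
def IsIndependentFamily {α : Type*} (F : Set (Set α)) : Prop :=
  ∀ (X : Set α) (n : ℕ) (Xs : Fin (n + 1) → Set α),
    X ∈ F → (∀ i, Xs i ∈ F) → X = ⋃ i, Xs i → ∃ i, X = Xs i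

/-- The family of constructible ring-theoretic ideals
`I(R) = { c⁻¹(a₁R ∩ … ∩ aₙR) : n ≥ 1, a₁,…,aₙ,c ∈ R∖{0} }`. -/
def cI (R : Type*) [CommRing R] : Set (Set R) :=
  { I | ∃ (n : ℕ) (a : Fin (n + 1) → R) (c : R), (∀ i, a i ≠ 0) ∧ c ≠ 0 ∧
      I = { r : R | ∀ i, ∃ t : R, c * r = a i * t } }

/-- The colon set `(R : J) = { q ∈ Q : qJ ⊆ R }` of a subset `J ⊆ Q`. -/
def colonSet (R : Type*) {Q : Type*} [CommRing R] [Field Q] [Algebra R Q]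
    (J : Set Q) : Set Q :=
  { q | ∀ x ∈ J, q * x ∈ Set.range (algebraMap R Q) }

theorem exists_equiv_fin_succ (ι : Type*) [Finite ι] [Nonempty ι] :
    ∃ n : ℕ, Nonempty (Fin (n + 1) ≃ ι) := by
  obtain ⟨m, ⟨e⟩⟩ := Finite.exists_equiv_fin ι
  cases m with
  | zero => exact (e (Classical.arbitrary ι)).elim0
  | succ n => exact ⟨n, ⟨e.symm⟩⟩

/-- Independence tested on unions indexed by an arbitrary nonempty finite type. -/
theorem IsIndependentFamily.exists_eq {α ι : Type*} [Finite ι] [Nonempty ι]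
    {F : Set (Set α)} (hF : IsIndependentFamily F) {X : Set α} {Xs : ι → Set α}
    (hX : X ∈ F) (hXs : ∀ i, Xs i ∈ F) (h : X = ⋃ i, Xs i) : ∃ i, X = Xs i := by
  obtain ⟨n, ⟨e⟩⟩ := exists_equiv_fin_succ ι
  obtain ⟨i, hi⟩ := hF X n (Xs ∘ e) hX (fun i ↦ hXs (e i))
    (h.trans (e.surjective.iUnion_comp Xs).symm)
  exact ⟨e i, hi⟩

section Constructible

variable {R : Type*} [CommRing R] [IsDomain R]

/-- A finite intersection of conductors `{r | b ∣ r * k}` is constructible. -/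
theorem setOf_forall_dvd_mul_mem_cI {ι : Type*} [Finite ι] [Nonempty ι] {b : R} (hb : b ≠ 0)
    {k : ι → R} (hk : ∀ i, k i ≠ 0) : {r : R | ∀ i, b ∣ r * k i} ∈ cI R := by
  classical
  obtain ⟨n, ⟨e⟩⟩ := exists_equiv_fin_succ ι
  have hprod (s : Finset (Fin (n + 1))) : ∏ j ∈ s, k (e j) ≠ 0 :=
    Finset.prod_ne_zero_iff.mpr fun j _ ↦ hk (e j)
  refine ⟨n, fun i ↦ b * ∏ j ∈ Finset.univ.erase i, k (e j), ∏ j, k (e j),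
    fun i ↦ mul_ne_zero hb (hprod _), hprod _, ?_⟩
  ext r
  simp only [Set.mem_ofPred_eq]
  rw [← e.forall_congr_right]
  refine forall_congr' fun i ↦ ?_
  rw [← Finset.mul_prod_erase Finset.univ (fun j ↦ k (e j)) (Finset.mem_univ i)]
  have h0 := hprod (Finset.univ.erase i)
  generalize ∏ j ∈ Finset.univ.erase i, k (e j) = p at h0
  change _ ↔ b * p ∣ k (e i) * p * r
  rw [mul_right_comm, mul_dvd_mul_iff_right h0, mul_comm r]

/-- Constructible ideals are nonzero ideals. -/
theorem exists_ideal_of_mem_cI {X : Set R} (hX : X ∈ cI R) :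
    ∃ I : Ideal R, I ≠ ⊥ ∧ (I : Set R) = X := by
  obtain ⟨n, a, c, ha, -, rfl⟩ := hX
  refine ⟨{ carrier := { r : R | ∀ i, a i ∣ c * r }
            add_mem' := fun hx hy i ↦ by rw [mul_add]; exact dvd_add (hx i) (hy i)
            zero_mem' := fun i ↦ by simp
            smul_mem' := fun r x hx i ↦ by
              rw [smul_eq_mul, mul_left_comm]; exact (hx i).mul_left r }, ?_, rfl⟩
  refine Submodule.ne_bot_iff _ |>.mpr ⟨∏ i, a i, fun i ↦ ?_,
    Finset.prod_ne_zero_iff.mpr fun i _ ↦ ha i⟩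
  exact (Finset.dvd_prod_of_mem a (Finset.mem_univ i)).mul_left c

/-- In a noetherian domain, a nonzero ideal whose extension to the fraction field is divisorial
is constructible. -/
theorem coe_mem_cI_of_divisorial {Q : Type*} [IsNoetherianRing R] [Field Q] [Algebra R Q]
    [IsFractionRing R Q] {I : Ideal R} (hI : I ≠ ⊥)
    (hdiv : ∀ q ∈ colonSet R (colonSet R (algebraMap R Q '' I)), q ∈ algebraMap R Q '' I) :
    (I : Set R) ∈ cI R := by
  classical
  have hinj := IsFractionRing.injective R Q
  obtain ⟨b, hbI, hb⟩ := Submodule.exists_mem_ne_zero_of_ne_bot hI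
  let K : Ideal R :=
    { carrier := { k : R | ∀ x ∈ I, b ∣ k * x }
      add_mem' := fun hk hl x hx ↦ by rw [add_mul]; exact dvd_add (hk x hx) (hl x hx)
      zero_mem' := fun x _ ↦ by simp
      smul_mem' := fun r k hk x hx ↦ by
        rw [smul_eq_mul, mul_assoc]; exact (hk x hx).mul_left r }
  have hbK : b ∈ K := fun x _ ↦ dvd_mul_right b x
  obtain ⟨s, hs⟩ := IsNoetherian.noetherian K
  let t : Finset R := insert b (s.erase 0)
  have htK : ∀ k ∈ t, k ∈ K := by
    intro k hk
    obtain rfl | hk := Finset.mem_insert.mp hk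
    · exact hbK
    · exact hs ▸ Submodule.subset_span (Finset.mem_of_mem_erase hk)
  have ht0 : ∀ k ∈ t, k ≠ 0 := by
    intro k hk
    obtain rfl | hk := Finset.mem_insert.mp hk
    · exact hb
    · exact Finset.ne_of_mem_erase hk
  have : Nonempty t := ⟨⟨b, Finset.mem_insert_self _ _⟩⟩
  convert setOf_forall_dvd_mul_mem_cI (ι := t) hb (k := fun i ↦ i.1) (fun i ↦ ht0 _ i.2)
  ext r
  refine ⟨fun hr i ↦ ?_, fun hr ↦ ?_⟩
  · rw [mul_comm]
    exact htK _ i.2 r hr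
  have hrK : ∀ k ∈ K, b ∣ r * k := by
    intro k hk
    rw [← hs] at hk
    induction hk using Submodule.span_induction with
    | mem k hk =>
      by_cases h0 : k = 0
      · simp [h0]
      · exact hr ⟨k, Finset.mem_insert_of_mem (Finset.mem_erase.mpr ⟨h0, hk⟩)⟩
    | zero => simp
    | add x y _ _ hx hy => rw [mul_add]; exact dvd_add hx hy
    | smul c x _ hx => rw [smul_eq_mul, mul_left_comm]; exact hx.mul_left c
  obtain ⟨r', hr', h⟩ := hdiv (algebraMap R Q r) fun q hq ↦ by
    obtain ⟨k, hk⟩ := hq _ ⟨b, hbI, rfl⟩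
    have hkK : k ∈ K := by
      intro x hx
      obtain ⟨y, hy⟩ := hq _ ⟨x, hx, rfl⟩
      refine ⟨y, hinj ?_⟩
      rw [map_mul, map_mul, hk, hy]
      ring
    obtain ⟨y, hy⟩ := hrK k hkK
    refine ⟨y, mul_left_cancel₀ ((map_ne_zero_iff _ hinj).mpr hb) ?_⟩
    rw [← map_mul, ← hy, map_mul, hk]
    ring
  exact hinj h ▸ hr'

end Constructible

section FiniteQuotients

variable {R : Type*} [CommRing R]

theorem finite_quotient_of_ne_bot (hfin : ∀ a : R, a ≠ 0 → Finite (R ⧸ Ideal.span {a}))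
    {I : Ideal R} (hI : I ≠ ⊥) : Finite (R ⧸ I) := by
  obtain ⟨a, haI, ha⟩ := Submodule.exists_mem_ne_zero_of_ne_bot hI
  have := hfin a ha
  exact Finite.of_surjective _
    (Ideal.Quotient.factor_surjective ((Ideal.span_singleton_le_iff_mem I).mpr haI))

/-- If `R ⧸ J` is finite, any ideal above `J` is a finite union of ideals of the form
`J ⊔ (x)`, so independence forces it to be of this form. -/
theorem IsIndependentFamily.exists_eq_sup_span_singleton
    (hind : IsIndependentFamily (cI R)) (hcI : ∀ I : Ideal R, I ≠ ⊥ → (I : Set R) ∈ cI R)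
    {I J : Ideal R} (hJ : J ≠ ⊥) (hJI : J ≤ I) [Finite (R ⧸ J)] :
    ∃ y, I = J ⊔ Ideal.span {y} := by
  have hout (x : R) : x - (Ideal.Quotient.mk J x).out ∈ J :=
    Ideal.Quotient.eq.mp (Quotient.out_eq' _).symm
  let ι := {q : R ⧸ J // q.out ∈ I}
  have hmem {x : R} (hx : x ∈ I) : (Ideal.Quotient.mk J x).out ∈ I :=
    (Submodule.sub_mem_iff_right I hx).mp (hJI (hout x))
  have : Nonempty ι := ⟨⟨_, hmem I.zero_mem⟩⟩
  obtain ⟨q, hq⟩ := hind.exists_eq (X := (I : Set R))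
    (Xs := fun q : ι ↦ ((J ⊔ Ideal.span {q.1.out} : Ideal R) : Set R))
    (hcI I (ne_bot_of_le_ne_bot hJ hJI))
    (fun q ↦ hcI _ (ne_bot_of_le_ne_bot hJ le_sup_left)) <| by
      refine Set.Subset.antisymm (fun x hx ↦ Set.mem_iUnion.mpr ⟨⟨_, hmem hx⟩, ?_⟩)
        (Set.iUnion_subset fun q ↦ ?_)
      · exact Submodule.mem_sup.mpr
          ⟨_, hout x, _, Ideal.mem_span_singleton_self _, sub_add_cancel _ _⟩
      · exact sup_le hJI ((Ideal.span_singleton_le_iff_mem I).mpr q.2)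
  exact ⟨_, SetLike.coe_injective hq⟩

end FiniteQuotients

section IntegrallyClosed

variable {R : Type*} [CommRing R] [IsDomain R]

/-- If every nonzero ideal is generated, modulo any smaller nonzero ideal, by one element, then
`R` is integrally closed. -/
theorem exists_algebraMap_eq_of_isIntegral [IsNoetherianRing R] {Q : Type*} [Field Q]
    [Algebra R Q] [IsFractionRing R Q]
    (h : ∀ I J : Ideal R, J ≠ ⊥ → J ≤ I → ∃ y, I = J ⊔ Ideal.span {y})
    {x : Q} (hx : IsIntegral R x) : ∃ r : R, algebraMap R Q r = x := by
  have hinj := IsFractionRing.injective R Q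
  let N : Submodule R Q := LinearMap.range (Algebra.linearMap R Q)
  let I : Ideal R := ⨅ n : ℕ, N.comap (LinearMap.toSpanSingleton R Q (x ^ n))
  let C : Ideal R := N.comap (LinearMap.toSpanSingleton R Q x)
  have memI (r : R) : r ∈ I ↔ ∀ n : ℕ, ∃ s, algebraMap R Q s = r • x ^ n := by
    simp [I, N]
  have memC (r : R) : r ∈ C ↔ ∃ s, algebraMap R Q s = r • x := by
    simp [C, N]
  obtain ⟨d, hd, hdx⟩ := hx.isAlmostIntegral
  have hd0 : d ≠ 0 := nonZeroDivisors.ne_zero hd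
  have hdI : d ∈ I := (memI d).mpr hdx
  have hdC : d ∈ C := (memC d).mpr (by simpa using hdx 1)
  have hCI : C * I ≠ ⊥ := (Submodule.ne_bot_iff _).mpr
    ⟨d * d, Ideal.mul_mem_mul hdC hdI, mul_ne_zero hd0 hd0⟩
  obtain ⟨y, hy⟩ := h I (C * I) hCI Ideal.mul_le_right
  have hyI : y ∈ I := hy ▸ Ideal.mem_sup_right (Ideal.mem_span_singleton_self y)
  obtain ⟨r, hrC, hr⟩ := Submodule.exists_sub_one_mem_and_smul_eq_zero_of_fg_of_le_smul C
    (Submodule.map (Submodule.mkQ (Ideal.span {y})) I) ((IsNoetherian.noetherian I).map _) <| by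
      conv_lhs => rw [hy]
      rw [Submodule.map_sup, ← Submodule.map_smul'', Submodule.mkQ_map_self, sup_bot_eq]
      rfl
  have hrI : ∀ z ∈ I, y ∣ r * z := fun z hz ↦ by
    have := hr _ (Submodule.mem_map_of_mem hz)
    rw [← map_smul, Submodule.mkQ_apply, Submodule.Quotient.mk_eq_zero] at this
    exact Ideal.mem_span_singleton.mp this
  obtain ⟨z, hz⟩ := (memI y).mp hyI 1
  rw [pow_one] at hz
  have hzI : z ∈ I := (memI z).mpr fun n ↦ by
    obtain ⟨s, hs⟩ := (memI y).mp hyI (n + 1)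
    refine ⟨s, hs.trans ?_⟩
    rw [Algebra.smul_def z, hz, pow_succ', smul_mul_assoc]
  have hr_mem : r ∈ C := by
    obtain ⟨t, ht⟩ := hrI z hzI
    refine (memC r).mpr ?_
    obtain rfl | hy0 := eq_or_ne y 0
    · obtain ⟨u, hu⟩ := hrI d hdI
      rw [zero_mul] at hu
      rw [(mul_eq_zero_iff_right hd0).mp hu]
      exact ⟨0, by simp⟩
    · refine ⟨t, mul_left_cancel₀ ((map_ne_zero_iff _ hinj).mpr hy0) ?_⟩
      rw [← map_mul, ← ht, map_mul, hz, Algebra.smul_def, Algebra.smul_def]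
      ring
  have h1 : (1 : R) ∈ C := by simpa using C.sub_mem hr_mem hrC
  simpa using (memC 1).mp h1

theorem isDedekindDomain_of_finite_quotients [IsNoetherianRing R] [IsIntegrallyClosed R]
    (hfin : ∀ a : R, a ≠ 0 → Finite (R ⧸ Ideal.span {a})) : IsDedekindDomain R :=
  { maximalOfPrime := fun {p} hp hprime ↦ by
      have := finite_quotient_of_ne_bot hfin hp
      exact Ideal.Quotient.maximal_of_isField p (Finite.isField_of_domain _) }

/-- In a Dedekind domain the constructible ideals are independent. -/
theorem isIndependentFamily_cI {R : Type*} [CommRing R] [IsDedekindDomain R] : IsIndependentFamily (cI R) := by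
  intro X n Xs hX hXs hU
  obtain ⟨I, -, rfl⟩ := exists_ideal_of_mem_cI hX
  choose K hK0 hK using fun i ↦ exists_ideal_of_mem_cI (hXs i)
  obtain rfl : (fun i ↦ (K i : Set R)) = Xs := funext hK
  have hKI : ∀ i, K i ≤ I := fun i ↦ by
    rw [← SetLike.coe_subset_coe, hU]
    exact Set.subset_iUnion (fun i ↦ (K i : Set R)) i
  have hJK : ∀ i, ∏ j, K j ≤ K i := fun i ↦
    Ideal.le_of_dvd (Finset.dvd_prod_of_mem K (Finset.mem_univ i))
  obtain ⟨a, ha⟩ := IsDedekindDomain.exists_sup_span_eq ((hJK 0).trans (hKI 0))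
    (Finset.prod_ne_zero_iff.mpr fun i _ ↦ hK0 i)
  have haI : a ∈ (I : Set R) := ha ▸ Ideal.mem_sup_right (Ideal.mem_span_singleton_self a)
  rw [hU] at haI
  obtain ⟨i, hi⟩ := Set.mem_iUnion.mp haI
  refine ⟨i, congrArg _ (le_antisymm ?_ (hKI i))⟩
  rw [← ha]
  exact sup_le (hJK i) ((Ideal.span_singleton_le_iff_mem _).mpr hi)

end IntegrallyClosed

/-- Let `R` be a noetherian integral domain with quotient field `Q` such that
every fractional ideal of `R` is divisorial (`I = (R:(R:I))`) and `R/aR` is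
finite for every `a ∈ R×`. Then `I(R)` is independent if and only if `R` is
integrally closed in `Q`. -/
theorem independent_iff_integrally_closed (R Q : Type*) [CommRing R] [IsDomain R]
    [IsNoetherianRing R] [Field Q] [Algebra R Q] [IsFractionRing R Q]
    (hdiv : ∀ I : Submodule R Q, I ≠ ⊥ →
      (∃ d : R, d ≠ 0 ∧ ∀ x ∈ I, algebraMap R Q d * x ∈ Set.range (algebraMap R Q)) →
      (I : Set Q) = colonSet R (colonSet R (I : Set Q)))
    (hfin : ∀ a : R, a ≠ 0 → Finite (R ⧸ Ideal.span {a})) :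
    IsIndependentFamily (cI R) ↔
      ∀ x : Q, IsIntegral R x → ∃ r : R, algebraMap R Q r = x := by
  have hcI : ∀ I : Ideal R, I ≠ ⊥ → (I : Set R) ∈ cI R := fun I hI ↦ by
    refine coe_mem_cI_of_divisorial (Q := Q) hI fun q hq ↦ ?_
    have h := hdiv (Submodule.map (Algebra.linearMap R Q) I) ?_ ⟨1, one_ne_zero, ?_⟩
    · exact h.superset hq
    · exact ((Submodule.map_injective_of_injective (f := Algebra.linearMap R Q)
        (IsFractionRing.injective R Q)).ne_iff' (Submodule.map_bot _)).mpr hI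
    · rintro _ ⟨r, -, rfl⟩
      exact ⟨r, by simp⟩
  refine ⟨fun hind x hx ↦ exists_algebraMap_eq_of_isIntegral (fun I J hJ hJI ↦ ?_) hx,
    fun hclosed ↦ ?_⟩
  · have := finite_quotient_of_ne_bot hfin hJ
    exact hind.exists_eq_sup_span_singleton hcI hJ hJI
  · have : IsIntegrallyClosed R := (isIntegrallyClosed_iff Q).mpr (hclosed _)
    have := isDedekindDomain_of_finite_quotients hfin
    exact isIndependentFamily_cI
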